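/- Let N = 2K+1, y : ZMod N → ℝ, and define the weighted absolute-error objective G_A(w) = inf_{x ∈ ℝ^N} Σ_{n=1}^{N} Σ_{k=−K}^{K} w_k |y_{n+k} − x_n|. Let W_symm (with ε = 0) be the set of tapered rectangle windows: simplex vectors with w_{−1} = w_0 = w_1, w_k = w_{−k} for all k, and w_k ≥ w_{k+1} for k ≥ 1. Then there exists i ∈ {1,…,K} such that the uniform window u_i of odd length 2i+1 ≥ 3 (u_{i,k} = 1/(2i+1) for |k| ≤ i, 0 otherwise) satisfies G_A(u_i) ≤ G_A(w) for all w ∈ W_symm; that is, an unweighted median filter of some odd length at least 3 is optimal among tapered rectangle windows for the least-absolutes criterion. -/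

import Mathlib

/-- The set of tapered rectangle windows: simplex vectors indexed by `k ∈ {-K, …, K}`
(zero outside) with `w (-1) = w 0 = w 1`, symmetric `w (-k) = w k`, and nonincreasing
away from the center. -/
def Tapered (K : ℕ) : Set (ℤ → ℝ) :=
  {w | (∀ k, 0 ≤ w k) ∧ (∀ k : ℤ, (K : ℤ) < |k| → w k = 0) ∧
       (∑ k ∈ Finset.Icc (-(K : ℤ)) (K : ℤ), w k = 1) ∧
       (w (-1) = w 0 ∧ w 0 = w 1) ∧ (∀ k : ℤ, w (-k) = w k) ∧
       (∀ k : ℤ, 1 ≤ k → w (k + 1) ≤ w k)}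

/-- The uniform (rectangle) window of length `2i+1`:
`u_{i,k} = 1/(2i+1)` for `|k| ≤ i`, `0` otherwise. -/
noncomputable def unif (i k : ℤ) : ℝ :=
  if |k| ≤ i then 1 / (2 * (i : ℝ) + 1) else 0

/-- The weighted absolute-error objective
`G_A w = inf_x ∑ n ∑ k w k |y (n+k) - x n|` with cyclic indices. -/
noncomputable def absObj (K : ℕ) (y : ZMod (2 * K + 1) → ℝ) (w : ℤ → ℝ) : ℝ :=
  ⨅ x : ZMod (2 * K + 1) → ℝ,
    ∑ n : ZMod (2 * K + 1), ∑ k ∈ Finset.Icc (-(K : ℤ)) (K : ℤ),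
      w k * |y (n + (k : ZMod (2 * K + 1))) - x n|

/-- Telescoping over the indices whose centered block contains position `m`. -/
lemma sum_range_telescope_ite (f : ℤ → ℝ) (m : ℤ) (K : ℕ) :
    (∑ i ∈ Finset.range K, if m ≤ (i : ℤ) + 1 then f (i + 1) - f (i + 2) else 0) =
      if m ≤ K then f (max 1 m) - f (K + 1) else 0 := by
  induction K with
  | zero =>
    by_cases h : m ≤ 0
    · have hmax : max 1 m = 1 := max_eq_left (by omega)
      simp [h, hmax]
    · simp [h]
  | succ K ih =>
    rw [Finset.sum_range_succ, ih]
    push_cast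
    have hK2 : (K : ℤ) + 1 + 1 = K + 2 := by ring
    rw [hK2]
    by_cases h : m ≤ K
    · rw [if_pos h, if_pos (by omega), if_pos (by omega)]
      ring
    · rw [if_neg h]
      by_cases h' : m ≤ (K : ℤ) + 1
      · have hmax : max 1 m = (K : ℤ) + 1 := by omega
        rw [if_pos h', if_pos h', hmax]
        ring
      · rw [if_neg h', if_neg h', add_zero]

lemma sum_unif {K : ℕ} {i : ℤ} (hi : 0 ≤ i) (hiK : i ≤ K) :
    ∑ k ∈ Finset.Icc (-(K : ℤ)) (K : ℤ), unif i k = 1 := by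
  have hfilter : (Finset.Icc (-(K : ℤ)) (K : ℤ)).filter (fun k => |k| ≤ i) =
      Finset.Icc (-i) i := by
    ext k
    simp only [Finset.mem_filter, Finset.mem_Icc, abs_le]
    omega
  have hcard : ((Finset.Icc (-i) i).card : ℝ) = 2 * (i : ℝ) + 1 := by
    have h : ((Finset.Icc (-i) i).card : ℤ) = 2 * i + 1 := by
      rw [Int.card_Icc]
      omega
    exact_mod_cast h
  have hpos : (0 : ℝ) ≤ i := by exact_mod_cast hi
  simp only [unif]
  rw [← Finset.sum_filter, hfilter, Finset.sum_const, nsmul_eq_mul, hcard]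
  field_simp

lemma unif_nonneg {i : ℤ} (hi : 0 ≤ i) (k : ℤ) : 0 ≤ unif i k := by
  have hpos : (0 : ℝ) ≤ i := by exact_mod_cast hi
  unfold unif
  split_ifs <;> positivity

/-- The coefficient of the window of length `2 i + 3` in a tapered rectangle window. -/
def rectCoeff (w : ℤ → ℝ) (i : ℕ) : ℝ :=
  (2 * (i : ℝ) + 3) * (w (i + 1) - w (i + 2))

lemma rectCoeff_nonneg {K : ℕ} {w : ℤ → ℝ} (hw : w ∈ Tapered K) (i : ℕ) :
    0 ≤ rectCoeff w i := by
  obtain ⟨-, -, -, -, -, hmono⟩ := hw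
  have h := hmono (i + 1) (by omega)
  rw [show (i : ℤ) + 1 + 1 = i + 2 by ring] at h
  exact mul_nonneg (by positivity) (sub_nonneg.2 h)

lemma Tapered.eq_sum_unif {K : ℕ} {w : ℤ → ℝ} (hw : w ∈ Tapered K) {k : ℤ} (hk : |k| ≤ K) :
    w k = ∑ i ∈ Finset.range K, rectCoeff w i * unif (i + 1) k := by
  obtain ⟨-, hzero, -, ⟨-, h01⟩, hsymm, -⟩ := hw
  have hterm : ∀ i : ℕ, rectCoeff w i * unif (i + 1) k =
      if |k| ≤ (i : ℤ) + 1 then w (i + 1) - w (i + 2) else 0 := by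
    intro i
    unfold rectCoeff unif
    split_ifs
    · push_cast
      have hne : 2 * ((i : ℝ) + 1) + 1 ≠ 0 := by positivity
      field_simp
      ring
    · rw [mul_zero]
  have hmax : w (max 1 |k|) = w k := by
    rcases eq_or_ne k 0 with rfl | h0
    · simpa using h01.symm
    · rw [max_eq_right (Int.one_le_abs h0)]
      rcases abs_choice k with h | h <;> rw [h]
      exact hsymm k
  have hend : w (K + 1) = 0 := hzero _ (by rw [abs_of_nonneg (by omega)]; omega)
  rw [Finset.sum_congr rfl fun i _ => hterm i, sum_range_telescope_ite w |k| K, if_pos hk,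
    hmax, hend, sub_zero]

lemma Tapered.sum_rectCoeff {K : ℕ} {w : ℤ → ℝ} (hw : w ∈ Tapered K) :
    ∑ i ∈ Finset.range K, rectCoeff w i = 1 := by
  rw [← hw.2.2.1, Finset.sum_congr rfl fun k hk =>
    Tapered.eq_sum_unif hw (abs_le.2 (Finset.mem_Icc.1 hk)), Finset.sum_comm]
  refine Finset.sum_congr rfl fun i hi => ?_
  have hiK := Finset.mem_range.1 hi
  rw [← Finset.mul_sum, sum_unif (by omega) (by omega), mul_one]

lemma absObj_le {K : ℕ} (y : ZMod (2 * K + 1) → ℝ) {w : ℤ → ℝ} (hw : ∀ k, 0 ≤ w k)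
    (x : ZMod (2 * K + 1) → ℝ) :
    absObj K y w ≤ ∑ n : ZMod (2 * K + 1), ∑ k ∈ Finset.Icc (-(K : ℤ)) (K : ℤ),
      w k * |y (n + (k : ZMod (2 * K + 1))) - x n| := by
  refine ciInf_le ⟨0, ?_⟩ x
  rintro _ ⟨x, rfl⟩
  exact Finset.sum_nonneg fun n _ => Finset.sum_nonneg fun k _ =>
    mul_nonneg (hw k) (abs_nonneg _)

lemma Tapered.sum_eq {K : ℕ} (y x : ZMod (2 * K + 1) → ℝ) {w : ℤ → ℝ} (hw : w ∈ Tapered K) :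
    ∑ n : ZMod (2 * K + 1), ∑ k ∈ Finset.Icc (-(K : ℤ)) (K : ℤ),
      w k * |y (n + (k : ZMod (2 * K + 1))) - x n| =
    ∑ i ∈ Finset.range K, rectCoeff w i *
      ∑ n : ZMod (2 * K + 1), ∑ k ∈ Finset.Icc (-(K : ℤ)) (K : ℤ),
        unif (i + 1) k * |y (n + (k : ZMod (2 * K + 1))) - x n| := by
  simp only [Finset.mul_sum]
  rw [Finset.sum_comm (s := Finset.range K)]
  refine Finset.sum_congr rfl fun n _ => ?_
  rw [Finset.sum_comm]
  refine Finset.sum_congr rfl fun k hk => ?_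
  rw [Tapered.eq_sum_unif hw (abs_le.2 (Finset.mem_Icc.1 hk)), Finset.sum_mul]
  exact Finset.sum_congr rfl fun i _ => mul_assoc _ _ _

/-- some uniform window `u_i` of odd length `2i+1 ≥ 3` (an unweighted
median filter) minimizes the least-absolutes objective `G_A` over all tapered rectangle
windows. -/
theorem best_rectangle_window_optimal_least_absolutes
    (K : ℕ) (hK : 1 ≤ K) (y : ZMod (2 * K + 1) → ℝ) :
    ∃ i ∈ Finset.Icc (1 : ℤ) (K : ℤ),
      ∀ w ∈ Tapered K, absObj K y (unif i) ≤ absObj K y w := by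
  obtain ⟨i, hi, hmin⟩ := Finset.exists_min_image (Finset.Icc (1 : ℤ) K)
    (fun i => absObj K y (unif i)) ⟨1, Finset.mem_Icc.2 ⟨le_rfl, by exact_mod_cast hK⟩⟩
  refine ⟨i, hi, fun w hw => le_ciInf fun x => ?_⟩
  rw [Tapered.sum_eq y x hw, ← one_mul (absObj K y (unif i)), ← Tapered.sum_rectCoeff hw,
    Finset.sum_mul]
  refine Finset.sum_le_sum fun j hj => mul_le_mul_of_nonneg_left ?_ (rectCoeff_nonneg hw j)
  have hjK := Finset.mem_range.1 hj
  exact (hmin (j + 1) (Finset.mem_Icc.2 ⟨by omega, by omega⟩)).trans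
    (absObj_le y (unif_nonneg (by omega)) x)
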